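/- arXiv:2001.06424 — 2 statements merged into one kernel-verified Lean document; each statement's English description precedes it below -/
import Mathlib

section
/- Let (U_i, 𝔅_i), i = 1,…,N, be measurable spaces whose σ-algebras contain all singletons, and let A, B : U = U_1 × ⋯ × U_N → ℝ be measurable functions such that A and B are integrable with respect to every product μ_1 × ⋯ × μ_N of probability measures μ_i on U_i and B is strictly of constant sign on U. If the test function C(u) = A(u)/B(u) is bounded above on U and attains its global maximum at a point u⁺ = (u_1⁺,…,u_N⁺) ∈ U, then the maximum of the linear-fractional integral functional I over all families (μ_1,…,μ_N) of probability measures exists and is attained at the family of degenerate (Dirac) measures (δ_{u_1⁺},…,δ_{u_N⁺}); moreover max over all families of I(μ_1,…,μ_N) = max over families of Dirac measures of I = I(δ_{u_1⁺},…,δ_{u_N⁺}) = max_{u ∈ U} A(u)/B(u) = A(u⁺)/B(u⁺). -/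
open MeasureTheory

/-- If `A / B ≤ c` everywhere and `B > 0`, then the ratio of the integrals is at most `c`. -/
theorem integral_div_integral_le_of_pos {X : Type*} [MeasurableSpace X] {ν : Measure X}
    [NeZero ν] {A B : X → ℝ} {c : ℝ} (hA : Integrable A ν) (hB : Integrable B ν)
    (hpos : ∀ x, 0 < B x) (hc : ∀ x, A x / B x ≤ c) :
    (∫ x, A x ∂ν) / (∫ x, B x ∂ν) ≤ c := by
  have hBpos : 0 < ∫ x, B x ∂ν := by
    rw [integral_pos_iff_support_of_nonneg (fun x => (hpos x).le) hB,
      Function.support_eq_univ fun x => (hpos x).ne']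
    exact NeZero.pos _
  rw [div_le_iff₀ hBpos, ← integral_const_mul]
  exact integral_mono hA (hB.const_mul c) fun x => (div_le_iff₀ (hpos x)).1 (hc x)

/-- If `A / B ≤ c` everywhere and `B` has strictly constant sign, then the ratio of the integrals
is at most `c`. -/
theorem integral_div_integral_le {X : Type*} [MeasurableSpace X] {ν : Measure X}
    [NeZero ν] {A B : X → ℝ} {c : ℝ} (hA : Integrable A ν) (hB : Integrable B ν)
    (hsign : (∀ x, 0 < B x) ∨ (∀ x, B x < 0)) (hc : ∀ x, A x / B x ≤ c) :
    (∫ x, A x ∂ν) / (∫ x, B x ∂ν) ≤ c := by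
  rcases hsign with hpos | hneg
  · exact integral_div_integral_le_of_pos hA hB hpos hc
  · have h := integral_div_integral_le_of_pos (A := fun x => -A x) (B := fun x => -B x)
      hA.neg hB.neg (fun x => neg_pos.2 (hneg x)) fun x => by simpa only [neg_div_neg_eq] using hc x
    simpa only [integral_neg, neg_div_neg_eq] using h

/-- A finite product of Dirac measures is the Dirac measure at the product point. -/
theorem pi_dirac_eq_dirac {ι : Type*} [Fintype ι] {U : ι → Type*}
    [∀ i, MeasurableSpace (U i)] (w : ∀ i, U i) :
    Measure.pi (fun i => Measure.dirac (w i)) = Measure.dirac w := by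
  classical
  refine Measure.pi_eq fun s hs => ?_
  rw [Measure.dirac_apply' _ (MeasurableSet.univ_pi hs)]
  simp only [Measure.dirac_apply' _ (hs _), Set.indicator_apply, Set.mem_univ_pi, Pi.one_apply]
  rw [Finset.prod_ite_zero]
  simp

/-- If the test function `C = A/B` attains its global maximum at `u⁺ ∈ U`, then the maximum
of the linear-fractional integral functional over all families of probability measures exists
and is attained at the family of Dirac measures concentrated at `u⁺`, with common value
`A(u⁺)/B(u⁺) = max_U C`. -/
theorem stmt_5 {N : ℕ} {U : Fin N → Type*} [∀ i, MeasurableSpace (U i)]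
    [∀ i, MeasurableSingletonClass (U i)]
    (A B : ((i : Fin N) → U i) → ℝ)
    (hAm : Measurable A) (hBm : Measurable B)
    (hA : ∀ μ : ∀ i, Measure (U i), (∀ i, IsProbabilityMeasure (μ i)) →
      Integrable A (Measure.pi μ))
    (hB : ∀ μ : ∀ i, Measure (U i), (∀ i, IsProbabilityMeasure (μ i)) →
      Integrable B (Measure.pi μ))
    (hBsign : (∀ u, 0 < B u) ∨ (∀ u, B u < 0))
    (uplus : (i : Fin N) → U i)
    (hmax : ∀ u, A u / B u ≤ A uplus / B uplus) :
    IsGreatest {r : ℝ | ∃ μ : ∀ i, Measure (U i), (∀ i, IsProbabilityMeasure (μ i)) ∧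
        r = (∫ u, A u ∂Measure.pi μ) / (∫ u, B u ∂Measure.pi μ)}
      (A uplus / B uplus) ∧
    IsGreatest {r : ℝ | ∃ w : (i : Fin N) → U i,
        r = (∫ v, A v ∂Measure.pi fun i => Measure.dirac (w i)) /
          (∫ v, B v ∂Measure.pi fun i => Measure.dirac (w i))}
      (A uplus / B uplus) ∧
    (∫ v, A v ∂Measure.pi fun i => Measure.dirac (uplus i)) /
      (∫ v, B v ∂Measure.pi fun i => Measure.dirac (uplus i)) = A uplus / B uplus := by
  have hdirac : ∀ w : ∀ i, U i,
      (∫ v, A v ∂Measure.pi fun i => Measure.dirac (w i)) /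
        (∫ v, B v ∂Measure.pi fun i => Measure.dirac (w i)) = A w / B w := fun w => by
    rw [pi_dirac_eq_dirac, integral_dirac' A w hAm.stronglyMeasurable,
      integral_dirac' B w hBm.stronglyMeasurable]
  refine ⟨⟨⟨fun i => Measure.dirac (uplus i), fun i => inferInstance, (hdirac uplus).symm⟩, ?_⟩,
    ⟨⟨uplus, (hdirac uplus).symm⟩, ?_⟩, hdirac uplus⟩
  · rintro r ⟨μ, hμ, rfl⟩
    exact integral_div_integral_le (hA μ hμ) (hB μ hμ) hBsign hmax
  · rintro r ⟨w, rfl⟩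
    rw [hdirac w]
    exact hmax w
end

section
/- Let (U_i, 𝔅_i), i = 1,…,N, be measurable spaces whose σ-algebras contain all singletons, with each U_i nonempty, and let A, B : U = U_1 × ⋯ × U_N → ℝ be measurable functions such that A and B are integrable with respect to every product μ_1 × ⋯ × μ_N of probability measures μ_i on U_i and B is strictly of constant sign on U. If the test function C(u) = A(u)/B(u) is bounded above on U, then the supremum of the linear-fractional integral functional I over all families (μ_1,…,μ_N) of probability measures equals the supremum of C over U: sup over all families of I(μ_1,…,μ_N) = sup over families of Dirac measures of I = sup_{u ∈ U} A(u)/B(u). -/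
open MeasureTheory

lemma integral_div_integral_le_of_pos_s11 {X : Type*} [MeasurableSpace X] {P : Measure X} [NeZero P]
    {f g : X → ℝ} (hf : Integrable f P) (hg : Integrable g P) (hpos : ∀ x, 0 < g x)
    {M : ℝ} (hM : ∀ x, f x / g x ≤ M) : (∫ x, f x ∂P) / (∫ x, g x ∂P) ≤ M := by
  have hint : 0 < ∫ x, g x ∂P := by
    rw [integral_pos_iff_support_of_nonneg (fun x => (hpos x).le) hg,
      Function.support_eq_univ fun x => (hpos x).ne']
    exact NeZero.pos _
  rw [div_le_iff₀ hint, ← integral_const_mul]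
  exact integral_mono hf (hg.const_mul M) fun x => (div_le_iff₀ (hpos x)).mp (hM x)

/-- A ratio of integrals with denominator of constant strict sign is bounded by any upper bound
of the pointwise ratio. -/
lemma integral_div_integral_le_s11 {X : Type*} [MeasurableSpace X] {P : Measure X} [NeZero P]
    {f g : X → ℝ} (hf : Integrable f P) (hg : Integrable g P)
    (hsign : (∀ x, 0 < g x) ∨ (∀ x, g x < 0))
    {M : ℝ} (hM : ∀ x, f x / g x ≤ M) : (∫ x, f x ∂P) / (∫ x, g x ∂P) ≤ M := by
  rcases hsign with hpos | hneg
  · exact integral_div_integral_le_of_pos_s11 hf hg hpos hM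
  · simpa [integral_neg, neg_div_neg_eq] using
      integral_div_integral_le_of_pos_s11 (M := M) hf.neg hg.neg (fun x => neg_pos.mpr (hneg x))
        (fun x => by simpa [neg_div_neg_eq] using hM x)

/-- If the test function `C = A/B` is bounded above on `U` (nonempty), then the supremum of the
linear-fractional integral functional over all families of probability measures equals its
supremum over families of Dirac measures, and both equal `sup_{u ∈ U} A(u)/B(u)`. -/
theorem stmt_11 {N : ℕ} {U : Fin N → Type*} [∀ i, MeasurableSpace (U i)]
    [∀ i, MeasurableSingletonClass (U i)] [∀ i, Nonempty (U i)]
    (A B : ((i : Fin N) → U i) → ℝ)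
    (hAm : Measurable A) (hBm : Measurable B)
    (hA : ∀ μ : ∀ i, Measure (U i), (∀ i, IsProbabilityMeasure (μ i)) →
      Integrable A (Measure.pi μ))
    (hB : ∀ μ : ∀ i, Measure (U i), (∀ i, IsProbabilityMeasure (μ i)) →
      Integrable B (Measure.pi μ))
    (hBsign : (∀ u, 0 < B u) ∨ (∀ u, B u < 0))
    (hbdd : BddAbove (Set.range fun u => A u / B u)) :
    sSup {r : ℝ | ∃ μ : ∀ i, Measure (U i), (∀ i, IsProbabilityMeasure (μ i)) ∧
        r = (∫ u, A u ∂Measure.pi μ) / (∫ u, B u ∂Measure.pi μ)} = (⨆ u, A u / B u) ∧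
    sSup {r : ℝ | ∃ w : (i : Fin N) → U i,
        r = (∫ v, A v ∂Measure.pi fun i => Measure.dirac (w i)) /
          (∫ v, B v ∂Measure.pi fun i => Measure.dirac (w i))} = (⨆ u, A u / B u) := by
  have pi_dirac_eq (w : (i : Fin N) → U i) :
      (Measure.pi fun i => Measure.dirac (w i)) = Measure.dirac w := by
    refine Measure.pi_eq fun s hs => ?_
    rw [Measure.dirac_apply' _ (MeasurableSet.univ_pi hs)]
    classical
    simp only [Measure.dirac_apply' _ (hs _), Set.indicator_apply, Set.mem_univ_pi,
      Pi.one_apply, Finset.prod_ite_zero, Finset.mem_univ, forall_const, Finset.prod_const_one]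
  have ratio_dirac (w : (i : Fin N) → U i) :
      (∫ v, A v ∂Measure.pi fun i => Measure.dirac (w i)) /
        (∫ v, B v ∂Measure.pi fun i => Measure.dirac (w i)) = A w / B w := by
    rw [pi_dirac_eq, integral_dirac' _ _ hAm.stronglyMeasurable,
      integral_dirac' _ _ hBm.stronglyMeasurable]
  constructor
  · refine IsLUB.csSup_eq ⟨?_, fun b hb => ciSup_le fun u => ?_⟩ ?_
    · rintro r ⟨μ, hμ, rfl⟩
      exact integral_div_integral_le_s11 (hA μ hμ) (hB μ hμ) hBsign fun u => le_ciSup hbdd u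
    · exact hb ⟨fun i => Measure.dirac (u i), fun i => inferInstance, (ratio_dirac u).symm⟩
    · exact ⟨_, fun i => Measure.dirac (Classical.arbitrary (U i)), fun i => inferInstance, rfl⟩
  · refine congrArg sSup (Set.ext fun r => ?_)
    simp only [ratio_dirac, Set.mem_ofPred_eq, Set.mem_range, eq_comm]
end
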